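/- The prime $2$ is Erdős-strong: if $A$ is a primitive set all of whose elements are even (equivalently, have least prime factor $2$), then $f(A) \leq \frac{1}{2 \log 2}$, i.e. $\sum_{a \in A} \frac{1}{a \log a} \leq \frac{1}{2 \log 2}$. -/

import Mathlib

/-- A set of natural numbers is primitive if no element divides another distinct element. -/
def Primitive (A : Set ℕ) : Prop := ∀ a ∈ A, ∀ b ∈ A, a ≠ b → ¬ a ∣ b

open ArithmeticFunction Finset in
/-- The cut argument: the total flow into `B` is at most the flow out of `1`. -/
theorem sum_le_of_flow {w : ℕ → ℝ} {B : Finset ℕ} (hw : ∀ n, 0 ≤ w n)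
    (hpos : ∀ b ∈ B, b ≠ 0) (hprim : ∀ a ∈ B, ∀ b ∈ B, a ≠ b → ¬ a ∣ b)
    (hout : ∀ m, m ≠ 0 → ∀ Q : Finset ℕ,
      ∑ q ∈ Q, vonMangoldt q / Real.log ((m * q : ℕ) : ℝ) * w (m * q) ≤ w m) :
    ∑ b ∈ B, w b ≤ w 1 := by
  classical
  by_cases h1 : 1 ∈ B
  · have : B = {1} := by
      refine eq_singleton_iff_unique_mem.2 ⟨h1, fun b hb ↦ ?_⟩
      by_contra hne
      exact hprim 1 h1 b hb (Ne.symm hne) (one_dvd b)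
    simp [this]
  rcases B.eq_empty_or_nonempty with rfl | ⟨b₀, hb₀⟩
  · simpa using hw 1
  set D : Finset ℕ := B.biUnion Nat.properDivisors with hD
  have hdisj : Disjoint B D := by
    rw [Finset.disjoint_left]
    intro a ha had
    obtain ⟨b, hb, hab⟩ := mem_biUnion.1 had
    rw [Nat.mem_properDivisors] at hab
    exact hprim a ha b hb hab.2.ne hab.1
  have h1D : 1 ∈ D := by
    refine mem_biUnion.2 ⟨b₀, hb₀, ?_⟩
    have := hpos _ hb₀
    have : b₀ ≠ 1 := fun h ↦ h1 (h ▸ hb₀)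
    rw [Nat.mem_properDivisors]
    exact ⟨one_dvd _, by omega⟩
  have hclosed : ∀ n ∈ B ∪ D, ∀ d ∈ n.properDivisors, d ∈ D := by
    intro n hn d hd
    rw [Nat.mem_properDivisors] at hd
    rcases mem_union.1 hn with hn | hn
    · exact mem_biUnion.2 ⟨n, hn, Nat.mem_properDivisors.2 hd⟩
    · obtain ⟨b, hb, hnb⟩ := mem_biUnion.1 hn
      rw [Nat.mem_properDivisors] at hnb
      exact mem_biUnion.2 ⟨b, hb, Nat.mem_properDivisors.2 ⟨hd.1.trans hnb.1, hd.2.trans hnb.2⟩⟩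
  have hDpos : ∀ d ∈ D, d ≠ 0 := by
    intro d hd
    obtain ⟨b, hb, hdb⟩ := mem_biUnion.1 hd
    exact (Nat.pos_of_mem_properDivisors hdb).ne'
  set F : ℕ → ℕ → ℝ := fun m q ↦ vonMangoldt q / Real.log ((m * q : ℕ) : ℝ) * w (m * q) with hF
  have hF0 : ∀ m q, 0 ≤ F m q := fun m q ↦
    mul_nonneg (div_nonneg vonMangoldt_nonneg (Real.log_natCast_nonneg _)) (hw _)
  set S : Finset ℕ := (B ∪ D).erase 1 with hS
  set Q : Finset ℕ := S.biUnion Nat.divisors with hQ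
  have hin : ∀ n ∈ S, w n = ∑ q ∈ n.divisors.erase 1, F (n / q) q := by
    intro n hn
    have hn1 : n ≠ 1 := (mem_erase.1 hn).1
    have hn0 : n ≠ 0 := by
      rcases mem_union.1 (mem_erase.1 hn).2 with h | h
      exacts [hpos _ h, hDpos _ h]
    have hlog : Real.log n ≠ 0 := by
      have : (1 : ℝ) < n := by exact_mod_cast (by omega : 1 < n)
      exact (Real.log_pos this).ne'
    have : ∀ q ∈ n.divisors.erase 1, F (n / q) q = vonMangoldt q * (w n / Real.log n) := by
      intro q hq
      have hq := Nat.dvd_of_mem_divisors (mem_erase.1 hq).2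
      simp only [hF, Nat.div_mul_cancel hq]
      ring
    rw [sum_congr rfl this, ← sum_mul, sum_erase _ vonMangoldt_apply_one, vonMangoldt_sum]
    field_simp
  have key : ∑ n ∈ S, w n ≤ ∑ m ∈ D, w m := by
    calc ∑ n ∈ S, w n = ∑ n ∈ S, ∑ q ∈ n.divisors.erase 1, F (n / q) q := sum_congr rfl hin
      _ = ∑ x ∈ S.sigma fun n ↦ n.divisors.erase 1, F (x.1 / x.2) x.2 := by
        rw [sum_sigma]
      _ = ∑ y ∈ (S.sigma fun n ↦ n.divisors.erase 1).image fun x ↦ (x.1 / x.2, x.2),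
            F y.1 y.2 := by
        rw [sum_image]
        rintro ⟨n, q⟩ hx ⟨n', q'⟩ hx' heq
        simp only [coe_sigma, Set.mem_sigma_iff, mem_coe, mem_erase, Nat.mem_divisors] at hx hx'
        simp only [Prod.mk.injEq] at heq
        obtain ⟨h, rfl⟩ := heq
        have := Nat.div_mul_cancel hx.2.2.1
        have h' := Nat.div_mul_cancel hx'.2.2.1
        rw [h, h'] at this
        rw [this]
      _ ≤ ∑ y ∈ D ×ˢ Q, F y.1 y.2 := by
        refine sum_le_sum_of_subset_of_nonneg ?_ fun y _ _ ↦ hF0 _ _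
        intro y hy
        obtain ⟨⟨n, q⟩, hx, rfl⟩ := mem_image.1 hy
        simp only [mem_sigma, mem_erase, Nat.mem_divisors] at hx
        refine mem_product.2 ⟨hclosed n (mem_erase.1 hx.1).2 _ ?_,
          mem_biUnion.2 ⟨n, hx.1, Nat.mem_divisors.2 hx.2.2⟩⟩
        rw [Nat.mem_properDivisors]
        refine ⟨Nat.div_dvd_of_dvd hx.2.2.1, Nat.div_lt_self (Nat.pos_of_ne_zero hx.2.2.2) ?_⟩
        have : q ≠ 0 := by
          rintro rfl
          exact hx.2.2.2 (zero_dvd_iff.1 hx.2.2.1)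
        have hq1 : q ≠ 1 := hx.2.1
        change 1 < q
        omega
      _ = ∑ m ∈ D, ∑ q ∈ Q, F m q := sum_product _ _ _
      _ ≤ ∑ m ∈ D, w m := sum_le_sum fun m hm ↦ hout m (hDpos m hm) Q
  have := add_sum_erase (B ∪ D) w (mem_union_right B h1D)
  rw [sum_union hdisj] at this
  linarith

open Real in
theorem antitoneOn_log_mul_rpow_neg {s : ℝ} (hs : 1 ≤ s) {m n : ℕ} (hm : 3 ≤ m) (hmn : m ≤ n) :
    log n * (n : ℝ) ^ (-s) ≤ log m * (m : ℝ) ^ (-s) := by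
  have hm3 : (3 : ℝ) ≤ m := by exact_mod_cast hm
  have hmn' : (m : ℝ) ≤ n := by exact_mod_cast hmn
  have hexp : exp s⁻¹ ≤ m :=
    calc exp s⁻¹ ≤ exp 1 := exp_le_exp.2 (inv_le_one_of_one_le₀ hs)
      _ ≤ 3 := (exp_one_lt_d9.trans (by norm_num)).le
      _ ≤ m := hm3
  have := log_div_self_rpow_antitoneOn (by linarith : 0 < s) (Set.mem_Ici.2 hexp)
    (Set.mem_Ici.2 (hexp.trans hmn')) hmn'
  simpa only [rpow_neg (Nat.cast_nonneg _), ← div_eq_mul_inv] using this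

open Real in
/-- The first terms of `∑ (-1)ⁿ log n / nˢ` have a nonnegative sum. -/
theorem log_three_add_log_five_le {s : ℝ} (hs : 1 ≤ s) :
    log 3 * 3 ^ (-s) + log 5 * 5 ^ (-s) ≤ log 2 * 2 ^ (-s) + log 4 * (4 : ℝ) ^ (-s) := by
  obtain ⟨t, ht, rfl⟩ : ∃ t : ℝ, 0 ≤ t ∧ s = 1 + 2 * t := ⟨(s - 1) / 2, by linarith, by ring⟩
  set b : ℝ := 2 ^ (-t) with hb
  have hb0 : 0 < b := by positivity
  have hb1 : b ≤ 1 := rpow_le_one_of_one_le_of_nonpos (by norm_num) (by linarith)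
  have split : ∀ x : ℝ, 0 < x → x ^ (-(1 + 2 * t)) = x⁻¹ * (x ^ 2) ^ (-t) := by
    intro x hx
    rw [← rpow_natCast, ← rpow_mul hx.le, ← rpow_neg_one x, ← rpow_add hx]
    push_cast
    ring_nf
  have pow2 : ∀ k : ℕ, ((2 : ℝ) ^ k) ^ (-t) = b ^ k := by
    intro k
    rw [hb, ← rpow_natCast, ← rpow_natCast, ← rpow_mul (by norm_num), ← rpow_mul (by norm_num)]
    ring_nf
  have h2 := split 2 (by norm_num)
  rw [pow2] at h2
  have h4 : (4 : ℝ) ^ (-(1 + 2 * t)) = 4⁻¹ * b ^ 4 := by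
    rw [split 4 (by norm_num), ← pow2]
    norm_num
  have h3 : (3 : ℝ) ^ (-(1 + 2 * t)) ≤ 3⁻¹ * b ^ 3 := by
    rw [split 3 (by norm_num), ← pow2]
    gcongr ?_ * ?_
    exact rpow_le_rpow_of_nonpos (by norm_num) (by norm_num) (by linarith)
  have h5 : (5 : ℝ) ^ (-(1 + 2 * t)) ≤ 5⁻¹ * b ^ 4 := by
    rw [split 5 (by norm_num), ← pow2]
    gcongr ?_ * ?_
    exact rpow_le_rpow_of_nonpos (by norm_num) (by norm_num) (by linarith)
  have l4 : log 4 = 2 * log 2 := by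
    rw [show (4 : ℝ) = 2 ^ 2 by norm_num, log_pow]
    norm_num
  have l3 : 0 < log 3 := log_pos (by norm_num)
  have l5 : 0 < log 5 := log_pos (by norm_num)
  have l23 : log 3 ≤ 3 * log 2 := by
    have := log_le_log (by norm_num) (by norm_num : (3 : ℝ) ≤ 2 ^ 3)
    rw [log_pow] at this
    exact_mod_cast this
  have l235 : 10 * log 3 + 6 * log 5 ≤ 30 * log 2 := by
    have := log_le_log (by norm_num) (by norm_num : (3 : ℝ) ^ 10 * 5 ^ 6 ≤ 2 ^ 30)
    rw [log_mul (by norm_num) (by norm_num), log_pow, log_pow, log_pow] at this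
    exact_mod_cast this
  rw [h2, h4, l4]
  have key : 0 ≤ log 2 / 2 * (1 + b ^ 2) - log 3 / 3 * b - log 5 / 5 * b ^ 2 := by
    have e1 : 0 ≤ (log 2 / 2 - log 3 / 6) * (1 - b ^ 2) :=
      mul_nonneg (by linarith) (by nlinarith)
    have e2 : 0 ≤ (log 2 - log 3 / 3 - log 5 / 5) * b ^ 2 :=
      mul_nonneg (by linarith) (by positivity)
    have e3 : 0 ≤ log 3 / 6 * (1 - b) ^ 2 := by positivity
    nlinarith
  have key' := mul_nonneg (sq_nonneg b) key
  have u3 := mul_le_mul_of_nonneg_left h3 l3.le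
  have u5 := mul_le_mul_of_nonneg_left h5 l5.le
  nlinarith

theorem LSeries.term_ofReal (f : ℕ → ℝ) {s : ℝ} (hs : s ≠ 0) :
    LSeries.term (fun n ↦ (f n : ℂ)) s = fun n : ℕ ↦ ((f n * (n : ℝ) ^ (-s) : ℝ) : ℂ) := by
  ext n
  rcases eq_or_ne n 0 with rfl | hn
  · simp [Real.zero_rpow (neg_ne_zero.2 hs)]
  · rw [LSeries.term_of_ne_zero hn, Real.rpow_neg (Nat.cast_nonneg n), Complex.ofReal_mul,
      Complex.ofReal_inv, Complex.ofReal_cpow (Nat.cast_nonneg n), Complex.ofReal_natCast,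
      div_eq_mul_inv]

open Real in
/-- Equivalently, the Dirichlet eta function is increasing on `[1, ∞)`. -/
theorem tsum_odd_log_le_tsum_even_log {s : ℝ} (hs : 1 ≤ s)
    (hsum : Summable fun n : ℕ ↦ log n * (n : ℝ) ^ (-s)) :
    ∑' k : ℕ, log (2 * k + 1 : ℕ) * ((2 * k + 1 : ℕ) : ℝ) ^ (-s) ≤
      ∑' k : ℕ, log (2 * k : ℕ) * ((2 * k : ℕ) : ℝ) ^ (-s) := by
  have he : Summable fun k : ℕ ↦ log (2 * k : ℕ) * ((2 * k : ℕ) : ℝ) ^ (-s) :=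
    hsum.comp_injective (i := fun k : ℕ ↦ 2 * k) fun a b h ↦ by simpa using h
  have ho : Summable fun k : ℕ ↦ log (2 * k + 1 : ℕ) * ((2 * k + 1 : ℕ) : ℝ) ^ (-s) :=
    hsum.comp_injective (i := fun k : ℕ ↦ 2 * k + 1) fun a b h ↦ by simpa using h
  rw [← he.sum_add_tsum_nat_add 3, ← ho.sum_add_tsum_nat_add 3]
  refine add_le_add ?_ (((summable_nat_add_iff 3).2 ho).tsum_le_tsum (fun k ↦ ?_)
    ((summable_nat_add_iff 3).2 he))
  · have := log_three_add_log_five_le hs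
    simp only [Finset.sum_range_succ, Finset.sum_range_zero]
    norm_num
    exact this
  · exact antitoneOn_log_mul_rpow_neg hs (by omega) (by omega)

open ArithmeticFunction hiding log in
open Real LSeries.notation in
/-- The identity `Λ * 1 = log` for real Dirichlet series. -/
theorem tsum_vonMangoldt_mul_tsum_rpow {s : ℝ} (hs : 1 < s) :
    Summable (fun n : ℕ ↦ vonMangoldt n * (n : ℝ) ^ (-s)) ∧
      Summable (fun n : ℕ ↦ 1 * (n : ℝ) ^ (-s)) ∧
      Summable (fun n : ℕ ↦ log n * (n : ℝ) ^ (-s)) ∧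
      (∑' n : ℕ, vonMangoldt n * (n : ℝ) ^ (-s)) * ∑' n : ℕ, 1 * (n : ℝ) ^ (-s) =
        ∑' n : ℕ, log n * (n : ℝ) ^ (-s) := by
  have hs0 : s ≠ 0 := by linarith
  have hs' : 1 < (s : ℂ).re := by simpa using hs
  have tV := LSeries.term_ofReal (fun n ↦ vonMangoldt n) hs0
  have tZ := LSeries.term_ofReal (fun _ ↦ 1) hs0
  have tD := LSeries.term_ofReal (fun n ↦ log n) hs0
  have eZ : (fun _ : ℕ ↦ ((1 : ℝ) : ℂ)) = 1 := by ext; simp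
  have eD : (fun n : ℕ ↦ ((log n : ℝ) : ℂ)) = (fun n : ℕ ↦ (vonMangoldt n : ℂ)) ⍟ 1 := by
    rw [convolution_vonMangoldt_const_one]
    ext n
    simp
  have cV := LSeriesSummable_vonMangoldt hs'
  have cZ : LSeriesSummable 1 (s : ℂ) := LSeriesSummable_one_iff.2 hs'
  have cD := cV.convolution cZ
  have prod := LSeries_convolution' cV cZ
  rw [eZ] at tZ
  rw [eD] at tD
  unfold LSeries at prod
  unfold LSeriesSummable at cV cZ cD
  rw [tV] at cV prod
  rw [tZ] at cZ prod
  rw [tD] at cD prod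
  refine ⟨Complex.summable_ofReal.1 cV, Complex.summable_ofReal.1 cZ,
    Complex.summable_ofReal.1 cD, Complex.ofReal_injective ?_⟩
  rw [Complex.ofReal_mul, Complex.ofReal_tsum, Complex.ofReal_tsum, Complex.ofReal_tsum]
  exact prod.symm

open ArithmeticFunction hiding log in
open Real in
/-- The bound `-ζ'(s)/ζ(s) ≤ log 2 / (2 ^ (s - 1) - 1)`, cleared of denominators. -/
theorem tsum_vonMangoldt_mul_rpow_le {s : ℝ} (hs : 1 < s) :
    Summable (fun n : ℕ ↦ vonMangoldt n * (n : ℝ) ^ (-s)) ∧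
      (1 - 2 * 2 ^ (-s)) * ∑' n : ℕ, vonMangoldt n * (n : ℝ) ^ (-s) ≤ 2 * 2 ^ (-s) * log 2 := by
  have hs0 : s ≠ 0 := by linarith
  obtain ⟨cV, cZ, cD, prod⟩ := tsum_vonMangoldt_mul_tsum_rpow hs
  refine ⟨cV, ?_⟩
  have even : ∀ k : ℕ, log (2 * k : ℕ) * ((2 * k : ℕ) : ℝ) ^ (-s) =
      2 ^ (-s) * (log 2 * (1 * (k : ℝ) ^ (-s)) + log k * (k : ℝ) ^ (-s)) := by
    intro k
    rcases eq_or_ne k 0 with rfl | hk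
    · simp [zero_rpow (neg_ne_zero.2 hs0)]
    · push_cast
      rw [log_mul two_ne_zero (by exact_mod_cast hk), mul_rpow zero_le_two (Nat.cast_nonneg k)]
      ring
  have hle := tsum_odd_log_le_tsum_even_log hs.le cD
  have hsplit := tsum_even_add_odd (f := fun n : ℕ ↦ log n * (n : ℝ) ^ (-s))
    (cD.comp_injective (i := fun k : ℕ ↦ 2 * k) fun a b h ↦ by simpa using h)
    (cD.comp_injective (i := fun k : ℕ ↦ 2 * k + 1) fun a b h ↦ by simpa using h)
  have heven : ∑' k : ℕ, log (2 * k : ℕ) * ((2 * k : ℕ) : ℝ) ^ (-s) =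
      2 ^ (-s) * (log 2 * ∑' k : ℕ, 1 * (k : ℝ) ^ (-s) + ∑' k : ℕ, log k * (k : ℝ) ^ (-s)) := by
    rw [tsum_congr even, tsum_mul_left, (cZ.mul_left _).tsum_add cD, tsum_mul_left]
  have hZ : 0 < ∑' k : ℕ, 1 * (k : ℝ) ^ (-s) :=
    cZ.tsum_pos (fun k ↦ by positivity) 1 (by simp)
  refine le_of_mul_le_mul_right ?_ hZ
  rw [heven] at hle hsplit
  rw [← prod] at hle hsplit
  linear_combination hle - hsplit

open Real MeasureTheory in
theorem integral_exp_neg_mul {a : ℝ} (ha : 0 < a) : ∫ t in Set.Ioi 0, exp (-a * t) = 1 / a := by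
  rw [integral_exp_mul_Ioi (neg_lt_zero.2 ha)]
  simp

open ArithmeticFunction hiding log in
open Real MeasureTheory in
theorem sum_vonMangoldt_div_le {m : ℕ} (hm : m ≠ 0) (Q : Finset ℕ) :
    ∑ q ∈ Q, vonMangoldt q / q * (1 / log (m * q) - 1 / log (2 * m * q)) ≤
      log 2 / log (2 * m) := by
  have hm1 : (1 : ℝ) ≤ m := by exact_mod_cast Nat.one_le_iff_ne_zero.2 hm
  have hmlog : 0 < log (2 * m) := log_pos (by linarith)
  let F : ℕ → ℝ → ℝ := fun q t ↦
    vonMangoldt q / q * (exp (-log (m * q) * t) - exp (-log (2 * m * q) * t))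
  have hF : ∀ q, IntegrableOn (F q) (Set.Ioi 0) ∧ ∫ t in Set.Ioi 0, F q t =
      vonMangoldt q / q * (1 / log (m * q) - 1 / log (2 * m * q)) := by
    intro q
    by_cases hq : vonMangoldt q = 0
    · simp [F, hq, IntegrableOn]
    have hq1 : (1 : ℝ) < q := by exact_mod_cast (vonMangoldt_ne_zero_iff.1 hq).one_lt
    have h1 : 0 < log (m * q) := log_pos (by nlinarith)
    have h2 : 0 < log (2 * m * q) := log_pos (by nlinarith)
    have i1 := integrableOn_exp_mul_Ioi (neg_lt_zero.2 h1) 0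
    have i2 := integrableOn_exp_mul_Ioi (neg_lt_zero.2 h2) 0
    refine ⟨(i1.sub i2).const_mul _, ?_⟩
    simp only [F]
    rw [integral_const_mul, integral_sub i1 i2, integral_exp_neg_mul h1, integral_exp_neg_mul h2]
  have hi := integrableOn_exp_mul_Ioi (neg_lt_zero.2 hmlog) 0
  calc _ = ∑ q ∈ Q, ∫ t in Set.Ioi 0, F q t := Finset.sum_congr rfl fun q _ ↦ (hF q).2.symm
    _ = ∫ t in Set.Ioi 0, ∑ q ∈ Q, F q t := (integral_finsetSum _ fun q _ ↦ (hF q).1).symm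
    _ ≤ ∫ t in Set.Ioi 0, log 2 * exp (-log (2 * m) * t) := by
      refine setIntegral_mono_on (integrable_finsetSum _ fun q _ ↦ (hF q).1) (hi.const_mul _)
        measurableSet_Ioi fun t ht ↦ ?_
      have ht : 0 < t := ht
      obtain ⟨hsum, hle⟩ := tsum_vonMangoldt_mul_rpow_le (s := 1 + t) (by linarith)
      have hpos : ∀ q : ℕ, 0 ≤ vonMangoldt q * (q : ℝ) ^ (-(1 + t)) := fun q ↦
        mul_nonneg vonMangoldt_nonneg (by positivity)
      have h2t : (2 : ℝ) * 2 ^ (-(1 + t)) = 2 ^ (-t) := by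
        nth_rewrite 1 [← rpow_one (2 : ℝ)]
        rw [← rpow_add two_pos]
        ring_nf
      rw [h2t] at hle
      have h2t1 : (2 : ℝ) ^ (-t) ≤ 1 :=
        rpow_le_one_of_one_le_of_nonpos one_le_two (by linarith)
      have hexp : ∀ x : ℝ, 0 < x → exp (-log x * t) = x ^ (-t) := fun x hx ↦ by
        rw [rpow_def_of_pos hx]
        ring_nf
      have hterm : ∀ q, F q t =
          (m : ℝ) ^ (-t) * (1 - 2 ^ (-t)) * (vonMangoldt q * (q : ℝ) ^ (-(1 + t))) := by
        intro q
        by_cases hq : vonMangoldt q = 0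
        · simp [F, hq]
        have hq0 : (0 : ℝ) < q := by exact_mod_cast (vonMangoldt_ne_zero_iff.1 hq).pos
        have hm0 : (0 : ℝ) < m := by linarith
        simp only [F]
        rw [hexp _ (by positivity), hexp _ (by positivity), mul_assoc (2 : ℝ),
          mul_rpow (x := 2) (by positivity) (by positivity),
          mul_rpow (x := (m : ℝ)) (by positivity) (by positivity), neg_add, rpow_add hq0,
          rpow_neg_one]
        ring
      have hm0 : (0 : ℝ) < m := by linarith
      have hfin := hsum.sum_le_tsum Q fun q _ ↦ hpos q
      rw [Finset.sum_congr rfl fun q _ ↦ hterm q, ← Finset.mul_sum, hexp _ (by positivity),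
        mul_rpow (by positivity) (by positivity)]
      calc _ ≤ (m : ℝ) ^ (-t) * (1 - 2 ^ (-t)) *
            ∑' q : ℕ, vonMangoldt q * (q : ℝ) ^ (-(1 + t)) :=
            mul_le_mul_of_nonneg_left hfin
              (mul_nonneg (by positivity) (sub_nonneg.2 h2t1))
        _ = (m : ℝ) ^ (-t) * ((1 - 2 ^ (-t)) *
            ∑' q : ℕ, vonMangoldt q * (q : ℝ) ^ (-(1 + t))) := by ring
        _ ≤ (m : ℝ) ^ (-t) * (2 ^ (-t) * log 2) :=
            mul_le_mul_of_nonneg_left hle (by positivity)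
        _ = _ := by ring
    _ = log 2 / log (2 * m) := by
      rw [integral_const_mul, integral_exp_neg_mul hmlog]
      ring

open ArithmeticFunction hiding log in
open Real in
/-- The flow `m → m * q` of size `Λ q / log (m * q) * w (m * q)`, where
`w k = 1 / (2 * k * log (2 * k))`, leaves
`m` with total at most `w m`. -/
theorem sum_vonMangoldt_outflow_le {m : ℕ} (hm : m ≠ 0) (Q : Finset ℕ) :
    ∑ q ∈ Q, vonMangoldt q / log ((m * q : ℕ) : ℝ) *
        (1 / ((2 * (m * q) : ℕ) * log (2 * (m * q) : ℕ))) ≤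
      1 / ((2 * m : ℕ) * log (2 * m : ℕ)) := by
  have hm1 : (1 : ℝ) ≤ m := by exact_mod_cast Nat.one_le_iff_ne_zero.2 hm
  have hm0 : (0 : ℝ) < m := by linarith
  have hl2 : 0 < log 2 := log_pos one_lt_two
  have hmlog : 0 < log (2 * m) := log_pos (by linarith)
  have hterm : ∀ q ∈ Q, vonMangoldt q / log ((m * q : ℕ) : ℝ) *
      (1 / ((2 * (m * q) : ℕ) * log (2 * (m * q) : ℕ))) =
      1 / (2 * m * log 2) *
        (vonMangoldt q / q * (1 / log (m * q) - 1 / log (2 * m * q))) := by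
    intro q _
    by_cases hq : vonMangoldt q = 0
    · simp [hq]
    have hq1 : (1 : ℝ) < q := by exact_mod_cast (vonMangoldt_ne_zero_iff.1 hq).one_lt
    have h1 : 0 < log (m * q) := log_pos (by nlinarith)
    have hsplit : log (2 * (m * q)) = log 2 + log (m * q) :=
      log_mul two_ne_zero (by positivity)
    push_cast
    rw [mul_assoc 2 (m : ℝ) (q : ℝ), hsplit]
    field_simp
    ring
  rw [Finset.sum_congr rfl hterm, ← Finset.mul_sum]
  calc _ ≤ 1 / (2 * m * log 2) * (log 2 / log (2 * m)) :=
        mul_le_mul_of_nonneg_left (sum_vonMangoldt_div_le hm Q) (by positivity)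
    _ = _ := by
      push_cast
      field_simp

theorem two_is_erdos_strong (A : Set ℕ) (hA : Primitive A) (heven : ∀ a ∈ A, 2 ∣ a) :
    ∑' a : A, 1 / (((a : ℕ) : ℝ) * Real.log ((a : ℕ) : ℝ)) ≤ 1 / (2 * Real.log 2) := by
  classical
  set w : ℕ → ℝ := fun k ↦ 1 / ((2 * k : ℕ) * Real.log (2 * k : ℕ)) with hw
  have hnonneg : ∀ n : ℕ, 0 ≤ 1 / ((n : ℝ) * Real.log n) := fun n ↦
    div_nonneg zero_le_one (mul_nonneg (Nat.cast_nonneg n) (Real.log_natCast_nonneg n))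
  refine Real.tsum_le_of_sum_le (fun a ↦ hnonneg a) fun T ↦ ?_
  set B : Finset ℕ := (T.image fun a : A ↦ (a : ℕ) / 2).erase 0 with hB
  have hmem : ∀ b ∈ B, b ≠ 0 ∧ 2 * b ∈ A := by
    intro b hb
    obtain ⟨hb0, hb⟩ := Finset.mem_erase.1 hb
    obtain ⟨a, -, rfl⟩ := Finset.mem_image.1 hb
    refine ⟨hb0, ?_⟩
    rw [Nat.mul_div_cancel' (heven a a.2)]
    exact a.2
  have hsum : ∑ a ∈ T, 1 / (((a : ℕ) : ℝ) * Real.log ((a : ℕ) : ℝ)) = ∑ b ∈ B, w b := by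
    rw [hB, Finset.sum_erase _ (by simp [hw]), Finset.sum_image]
    · refine Finset.sum_congr rfl fun a _ ↦ ?_
      simp only [hw, Nat.mul_div_cancel' (heven a a.2)]
    · intro a _ b _ hab
      have ha := Nat.mul_div_cancel' (heven a a.2)
      have hb := Nat.mul_div_cancel' (heven b b.2)
      simp only at hab
      exact Subtype.ext (by omega)
  have hmain : ∑ b ∈ B, w b ≤ w 1 := by
    refine sum_le_of_flow (fun n ↦ hnonneg (2 * n)) (fun b hb ↦ (hmem b hb).1) ?_
      fun m hm Q ↦ sum_vonMangoldt_outflow_le hm Q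
    intro a ha b hb hab hdvd
    exact hA _ (hmem a ha).2 _ (hmem b hb).2 (by omega) (Nat.mul_dvd_mul_left 2 hdvd)
  rw [hsum]
  simpa [hw] using hmain
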